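/- For 0 ≤ m ≤ n/2, the number of rooted spanning trees of the Grassmann graph C_q(n,m) equals Π_{k=1}^{m} ([k]_q·[n−k+1]_q)^{[n choose k]_q − [n choose k−1]_q}, where [j]_q = 1 + q + ... + q^{j−1}. -/

import Mathlib

/-- The Gaussian (q-)binomial coefficient, via the q-Pascal recursion. -/
def gaussBinom (q : ℕ) : ℕ → ℕ → ℕ
  | _, 0 => 1
  | 0, _ + 1 => 0
  | n + 1, k + 1 => gaussBinom q n k + q ^ (k + 1) * gaussBinom q n (k + 1)

/-- The q-integer `[j]_q = 1 + q + ⋯ + q^{j-1}`. -/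
def qInt (q j : ℕ) : ℕ := ∑ i ∈ Finset.range j, q ^ i

open Finset Matrix in
/-- The matrix with rows `e_i - e_{f i}` for `i ≠ r`, and `e_r` as row `r`, is unimodular when `f`
eventually maps every vertex to `r`, and singular otherwise. -/
theorem det_parent_matrix {V : Type*} [Fintype V] [DecidableEq V] (r : V) (f : V → V)
    (hr : f r = r) [Decidable (∀ v, ∃ k, f^[k] v = r)] :
    Matrix.det (fun i => if i = r then Pi.single r 1 else Pi.single i 1 - Pi.single (f i) 1 :
      Matrix V V ℤ) = if ∀ v, ∃ k, f^[k] v = r then 1 else 0 := by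
  classical
  set M : Matrix V V ℤ :=
    fun i => if i = r then Pi.single r 1 else Pi.single i 1 - Pi.single (f i) 1 with hM
  split_ifs with h
  · let depth : V → ℕ := fun v => Nat.find (h v)
    have depth_lt : ∀ i, i ≠ r → depth (f i) < depth i := by
      intro i hi
      have h0 : depth i ≠ 0 := by
        intro h0
        have := Nat.find_spec (h i)
        change f^[depth i] i = r at this
        rw [h0] at this
        exact hi this
      obtain ⟨k, hk⟩ := Nat.exists_eq_succ_of_ne_zero h0
      have hs : f^[depth i] i = r := Nat.find_spec (h i)
      rw [hk, Function.iterate_succ_apply] at hs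
      have : depth (f i) ≤ k := Nat.find_min' (h (f i)) hs
      omega
    have apply_ne : ∀ i j, i ≠ j → depth i ≤ depth j → M i j = 0 := by
      intro i j hij hd
      by_cases hi : i = r
      · subst hi
        simp [hM, hij.symm]
      · have : j ≠ f i := by
          rintro rfl
          exact absurd (depth_lt i hi) (by omega)
        simp [hM, hi, hij.symm, this]
    have apply_eq : ∀ i, M i i = 1 := by
      intro i
      by_cases hi : i = r
      · simp [hM, hi]
      · have : i ≠ f i := fun hf => absurd (depth_lt i hi) (by rw [← hf]; omega)
        simp [hM, hi, this]
    have htri : M.BlockTriangular (fun v => OrderDual.toDual (depth v)) := by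
      intro i j hij
      have hij' : depth i < depth j := hij
      exact apply_ne i j (fun e => by simp [e] at hij') hij'.le
    rw [htri.det]
    refine prod_eq_one fun k _ => ?_
    have : M.toSquareBlock (fun v => OrderDual.toDual (depth v)) k = 1 := by
      ext ⟨i, hi⟩ ⟨j, hj⟩
      by_cases hij : i = j
      · subst hij
        simp [toSquareBlock_def, apply_eq]
      · have : depth i = depth j := OrderDual.toDual.injective (hi.trans hj.symm)
        rw [Matrix.one_apply_ne (by simpa using hij)]
        exact apply_ne i j hij this.le
    rw [this, det_one]
  · push Not at h
    obtain ⟨v₀, hv₀⟩ := h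
    refine Matrix.exists_mulVec_eq_zero_iff.mp
      ⟨fun v => if ∃ k, f^[k] v = r then 0 else 1, ?_, ?_⟩
    · intro h0
      have := congrFun h0 v₀
      simp [hv₀] at this
    · ext i
      by_cases hi : i = r
      · have : ∃ k, f^[k] r = r := ⟨0, rfl⟩
        simp [hM, mulVec, hi, this]
      · have : (∃ k, f^[k] i = r) ↔ ∃ k, f^[k] (f i) = r := by
          constructor
          · rintro ⟨k, hk⟩
            refine ⟨k, ?_⟩
            rw [← Function.iterate_succ_apply, Function.iterate_succ_apply', hk, hr]
          · rintro ⟨k, hk⟩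
            exact ⟨k + 1, hk⟩
        have hrow : M i = Pi.single i 1 - Pi.single (f i) 1 := by simp [hM, hi]
        rw [mulVec, hrow, sub_dotProduct]
        simp [this]

namespace SimpleGraph

variable {V : Type*}

/-- `f` is the parent function of a spanning tree of `G` with root `r`. -/
def IsParentFun (G : SimpleGraph V) (r : V) (f : V → V) : Prop :=
  f r = r ∧ (∀ v, v ≠ r → G.Adj v (f v)) ∧ ∀ v, ∃ k, f^[k] v = r

namespace IsParentFun

variable {G : SimpleGraph V} {r : V} {f g : V → V}

theorem fromRel_le (hf : G.IsParentFun r f) : fromRel (fun u v => f u = v) ≤ G := by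
  have key : ∀ u v, u ≠ v → f u = v → G.Adj u v := by
    rintro u v huv rfl
    exact hf.2.1 u fun hu => huv (by rw [hu, hf.1])
  rw [le_iff_adj]
  rintro u v ⟨huv, h | h⟩
  · exact key u v huv h
  · exact (key v u huv.symm h).symm

theorem connected_fromRel (hf : G.IsParentFun r f) : (fromRel fun u v => f u = v).Connected := by
  have reach : ∀ k v, f^[k] v = r → (fromRel fun u v => f u = v).Reachable v r := by
    intro k
    induction k with
    | zero => rintro v rfl; exact Reachable.refl _
    | succ k ih =>
      intro v hv
      refine Reachable.trans ?_ (ih (f v) hv)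
      by_cases hvf : v = f v
      · rw [← hvf]
      · exact Adj.reachable ((fromRel_adj _ _ _).2 ⟨hvf, Or.inl rfl⟩)
  refine connected_iff_exists_forall_reachable _ |>.2 ⟨r, fun v => ?_⟩
  obtain ⟨k, hk⟩ := hf.2.2 v
  exact (reach k v hk).symm

theorem isTree_fromRel [Finite V] (hf : G.IsParentFun r f) :
    (fromRel fun u v => f u = v).IsTree := by
  classical
  have := Fintype.ofFinite V
  refine isTree_iff_connected_and_card.2 ⟨hf.connected_fromRel, le_antisymm ?_
    hf.connected_fromRel.card_vert_le_card_edgeSet_add_one⟩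
  have hsub : (fromRel fun u v => f u = v).edgeSet ⊆
      ((Finset.univ.erase r).image fun v => s(v, f v) : Finset (Sym2 V)) := by
    intro e
    induction e with | _ u v
    have hne : ∀ u v, u ≠ v → f u = v → u ≠ r := by
      rintro u v huv rfl rfl
      exact huv hf.1.symm
    rintro ⟨huv, h | h⟩
    · simpa using ⟨u, hne u v huv h, Or.inl ⟨rfl, h⟩⟩
    · simpa using ⟨v, hne v u huv.symm h, Or.inr ⟨rfl, h⟩⟩
  have h1 := Set.ncard_le_ncard hsub
  rw [Set.ncard_coe_finset] at h1
  have h2 := h1.trans Finset.card_image_le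
  rw [Finset.card_erase_of_mem (Finset.mem_univ r), Finset.card_univ] at h2
  have h3 : 0 < Fintype.card V := Fintype.card_pos_iff.2 ⟨r⟩
  rw [Nat.card_eq_fintype_card (α := V)]
  change Set.ncard _ + 1 ≤ _
  omega

theorem eq_of_fromRel_eq (hf : G.IsParentFun r f) (hg : G.IsParentFun r g)
    (h : fromRel (fun u v => f u = v) = fromRel fun u v => g u = v) : f = g := by
  by_contra hfg
  obtain ⟨v₀, hv₀⟩ := Function.ne_iff.1 hfg
  have step : ∀ v, f v ≠ g v → g (f v) = v ∧ f (f v) ≠ g (f v) := by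
    intro v hv
    have hvr : v ≠ r := by
      rintro rfl
      exact hv (hf.1.trans hg.1.symm)
    have hadj : (fromRel fun u v => g u = v).Adj v (f v) := by
      rw [← h]
      exact (fromRel_adj _ _ _).2 ⟨(hf.2.1 v hvr).ne, Or.inl rfl⟩
    have hgf : g (f v) = v := hadj.2.resolve_left fun e => hv e.symm
    refine ⟨hgf, fun hff => ?_⟩
    rw [hgf] at hff
    have cyc : ∀ k, f^[k] v = v ∨ f^[k] v = f v := by
      intro k
      induction k with
      | zero => exact Or.inl rfl
      | succ k ih =>
        rw [Function.iterate_succ_apply']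
        rcases ih with e | e <;> rw [e] <;> simp [hff]
    obtain ⟨k, hk⟩ := hf.2.2 v
    rcases cyc k with e | e
    · exact hvr (e.symm.trans hk)
    · have : f v = r := e.symm.trans hk
      rw [this, hf.1] at hff
      exact hvr hff.symm
  have iter : ∀ k, f (f^[k] v₀) ≠ g (f^[k] v₀) := by
    intro k
    induction k with
    | zero => exact hv₀
    | succ k ih =>
      rw [Function.iterate_succ_apply']
      exact (step _ ih).2
  obtain ⟨k, hk⟩ := hf.2.2 v₀
  apply iter k
  rw [hk, hf.1, hg.1]

end IsParentFun

/-- A spanning tree has a parent function towards any chosen root. -/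
theorem IsTree.exists_isParentFun {G T : SimpleGraph V} (hT : T.IsTree) (hTG : T ≤ G) (r : V) :
    ∃ f, G.IsParentFun r f ∧ fromRel (fun u v => f u = v) = T := by
  classical
  have hc := hT.connected
  have closer : ∀ v, ∃ u, (v = r → u = r) ∧ (v ≠ r → T.Adj v u ∧ T.dist u r < T.dist v r) := by
    intro v
    by_cases hv : v = r
    · exact ⟨r, fun _ => rfl, fun h => absurd hv h⟩
    · obtain ⟨p, hp⟩ := hc.exists_walk_length_eq_dist v r
      cases p with
      | nil => exact absurd rfl hv
      | @cons _ u _ h p =>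
        refine ⟨u, fun h => absurd h hv, fun _ => ⟨h, ?_⟩⟩
        have := T.dist_le p
        rw [Walk.length_cons] at hp
        omega
  choose f hfr hf using closer
  have reach : ∀ d v, T.dist v r ≤ d → ∃ k, f^[k] v = r := by
    intro d
    induction d with
    | zero =>
      intro v hv
      exact ⟨0, hc.dist_eq_zero_iff.1 (Nat.le_zero.1 hv)⟩
    | succ d ih =>
      intro v hv
      by_cases hvr : v = r
      · exact ⟨0, hvr⟩
      · obtain ⟨k, hk⟩ := ih (f v) (by have := (hf v hvr).2; omega)
        exact ⟨k + 1, hk⟩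
  have hpT : T.IsParentFun r f := ⟨hfr r rfl, fun v hv => (hf v hv).1, fun v => reach _ v le_rfl⟩
  refine ⟨f, ⟨hpT.1, fun v hv => hTG (hpT.2.1 v hv), hpT.2.2⟩, ?_⟩
  exact (isTree_iff_minimal_connected.1 hT).eq_of_le hpT.connected_fromRel hpT.fromRel_le

/-- Spanning trees correspond to parent functions towards a fixed root. -/
theorem natCard_spanningTrees_eq [Finite V] (G : SimpleGraph V) (r : V) :
    Nat.card {T : SimpleGraph V // T ≤ G ∧ T.IsTree} = Nat.card {f // G.IsParentFun r f} := by
  symm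
  refine Nat.card_congr (Equiv.ofBijective
    (fun f => ⟨fromRel fun u v => f.1 u = v, f.2.fromRel_le, f.2.isTree_fromRel⟩) ⟨?_, ?_⟩)
  · rintro ⟨f, hf⟩ ⟨g, hg⟩ h
    exact Subtype.ext (hf.eq_of_fromRel_eq hg (congrArg Subtype.val h))
  · rintro ⟨T, hTG, hT⟩
    obtain ⟨f, hf, rfl⟩ := hT.exists_isParentFun hTG r
    exact ⟨⟨f, hf⟩, rfl⟩

open Finset in
/-- The matrix-tree theorem: deleting the row and the column of a vertex from the Laplacian leaves
a matrix whose determinant is the number of spanning trees. -/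
theorem det_submatrix_lapMatrix [Fintype V] [DecidableEq V] (G : SimpleGraph V)
    [DecidableRel G.Adj] (r : V) :
    ((G.lapMatrix ℤ).submatrix (Subtype.val : ↥(univ.erase r) → V) Subtype.val).det =
      Nat.card {T : SimpleGraph V // T ≤ G ∧ T.IsTree} := by
  classical
  let A : V → Finset V := fun i => if i = r then {r} else G.neighborFinset i
  let g : V → V → V → ℤ :=
    fun i j => if i = r then Pi.single r 1 else Pi.single i 1 - Pi.single j 1
  have hrows : (univ.erase r).piecewise (G.lapMatrix ℤ).row (1 : Matrix V V ℤ).row =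
      fun i => ∑ j ∈ A i, g i j := by
    funext i
    by_cases hi : i = r
    · subst hi
      rw [piecewise_eq_of_notMem _ _ _ (notMem_erase _ _)]
      ext j
      simp [A, g, Matrix.one_apply, Pi.single_apply, eq_comm]
    · rw [piecewise_eq_of_mem _ _ _ (mem_erase.2 ⟨hi, mem_univ i⟩)]
      ext j
      simp [A, g, hi, lapMatrix, degMatrix, Finset.sum_apply, Pi.single_apply,
        Matrix.diagonal_apply, eq_comm (a := i)]
  rw [← Matrix.det_piecewise_one_eq_submatrix_det, hrows]
  have := (Matrix.detRowAlternating (R := ℤ) (n := V)).toMultilinearMap.map_sum_finset g A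
  refine this.trans ?_
  have hsum : ∀ f ∈ Fintype.piFinset A, Matrix.detRowAlternating (fun i => g i (f i)) =
      if ∀ v, ∃ k, f^[k] v = r then (1 : ℤ) else 0 := by
    intro f hf
    have hr : f r = r := by simpa [A] using Fintype.mem_piFinset.1 hf r
    exact det_parent_matrix r f hr
  refine (sum_congr rfl hsum).trans ?_
  rw [natCard_spanningTrees_eq G r, sum_boole, Nat.card_eq_fintype_card,
    Fintype.card_of_subtype]
  intro f
  rw [mem_filter, Fintype.mem_piFinset, IsParentFun, ← and_assoc]
  refine and_congr_left fun _ => ⟨fun h => ⟨by simpa [A] using h r, fun v hv => ?_⟩, ?_⟩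
  · simpa [A, hv] using h v
  · rintro ⟨h1, h2⟩ v
    by_cases hv : v = r
    · simp [A, hv, h1]
    · simpa [A, hv] using h2 v hv

open Finset in
/-- The linear coefficient of the characteristic polynomial of the negated Laplacian counts
rooted spanning trees. -/
theorem coeff_one_charpoly_neg_lapMatrix [Fintype V] [DecidableEq V] [Nonempty V]
    (G : SimpleGraph V) [DecidableRel G.Adj] :
    (-G.lapMatrix ℤ).charpoly.coeff 1 =
      Nat.card ({T : SimpleGraph V // T ≤ G ∧ T.IsTree} × V) := by
  classical
  have hV : 0 < Fintype.card V := Fintype.card_pos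
  have h := (-G.lapMatrix ℤ).charpoly_coeff_eq_sum_minors (Fintype.card V - 1) (Nat.sub_le _ _)
  rw [Nat.sub_sub_self hV] at h
  have hs : univ.powersetCard (Fintype.card V - 1) = univ.image fun r : V => univ.erase r := by
    ext s
    simp only [mem_powersetCard, subset_univ, true_and, mem_image, mem_univ]
    constructor
    · intro hs
      have : #sᶜ = 1 := by rw [card_compl, hs]; omega
      obtain ⟨r, hr⟩ := card_eq_one.1 this
      exact ⟨r, by rw [← compl_singleton, ← hr, compl_compl]⟩
    · rintro ⟨r, rfl⟩
      rw [card_erase_of_mem (mem_univ r), card_univ]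
  rw [h, hs, sum_image]
  · have hminor : ∀ r : V, ((-G.lapMatrix ℤ).submatrix
        (Subtype.val : ↥(univ.erase r) → V) Subtype.val).det =
        (-1) ^ (Fintype.card V - 1) * Nat.card {T : SimpleGraph V // T ≤ G ∧ T.IsTree} := by
      intro r
      rw [← det_submatrix_lapMatrix G r, Matrix.submatrix_neg, Pi.neg_apply, Pi.neg_apply,
        Matrix.det_neg, Fintype.card_coe, card_erase_of_mem (mem_univ r), card_univ]
    rw [sum_congr rfl fun r _ => hminor r, sum_const, card_univ, Nat.card_prod,
      Nat.card_eq_fintype_card (α := V), nsmul_eq_mul, mul_left_comm, ← mul_assoc, ← mul_assoc,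
      mul_assoc (Fintype.card V : ℤ), ← mul_pow]
    push_cast
    ring
  · intro r _ s _ hrs
    by_contra hne
    have : r ∈ Finset.univ.erase s := by simp [hne]
    simp [← hrs] at this

end SimpleGraph

theorem gaussBinom_zero (q n : ℕ) : gaussBinom q n 0 = 1 := by
  cases n <;> rfl

theorem gaussBinom_eq_zero_of_lt (q : ℕ) : ∀ {n k : ℕ}, n < k → gaussBinom q n k = 0
  | 0, _ + 1, _ => rfl
  | n + 1, k + 1, h => by
    rw [gaussBinom, gaussBinom_eq_zero_of_lt q (Nat.lt_of_succ_lt_succ h),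
      gaussBinom_eq_zero_of_lt q (Nat.lt_of_succ_lt h), mul_zero, add_zero]

theorem gaussBinom_pos (q : ℕ) : ∀ {n k : ℕ}, k ≤ n → 0 < gaussBinom q n k
  | n, 0, _ => by rw [gaussBinom_zero]; exact Nat.one_pos
  | n + 1, k + 1, h => Nat.add_pos_left (gaussBinom_pos q (Nat.le_of_succ_le_succ h)) _

theorem qInt_add (q a b : ℕ) : qInt q (a + b) = qInt q a + q ^ a * qInt q b := by
  simp only [qInt, Finset.sum_range_add, pow_add, Finset.mul_sum]

theorem qInt_one (q : ℕ) : qInt q 1 = 1 := by simp [qInt]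

theorem qInt_mono (q : ℕ) : Monotone (qInt q) := fun _ _ h =>
  Finset.sum_le_sum_of_subset (Finset.range_mono h)

theorem qInt_pos (q : ℕ) {j : ℕ} (hj : 0 < j) : 0 < qInt q j :=
  Nat.one_pos.trans_le ((qInt_one q).ge.trans (qInt_mono q hj))

theorem gaussBinom_succ_mul_qInt (q n k : ℕ) :
    gaussBinom q n (k + 1) * qInt q (k + 1) = gaussBinom q n k * qInt q (n - k) := by
  induction n generalizing k with
  | zero => simp [gaussBinom, qInt]
  | succ n ih =>
    cases k with
    | zero =>
      have h := ih 0
      rw [gaussBinom_zero, Nat.sub_zero, Nat.zero_add, qInt_one, mul_one, one_mul] at h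
      rw [gaussBinom_zero, Nat.zero_add, gaussBinom, gaussBinom_zero, Nat.zero_add, Nat.sub_zero, h,
        qInt_one, add_comm n 1, qInt_add, qInt_one]
      ring
    | succ j =>
      rw [gaussBinom, add_mul, mul_assoc, ih (j + 1), gaussBinom, Nat.add_sub_add_right, add_mul,
        ← ih j]
      rcases lt_or_ge n (j + 1) with hn | hn
      · simp [gaussBinom_eq_zero_of_lt q hn]
      · obtain ⟨d, rfl⟩ := Nat.exists_eq_add_of_le hn
        have h1 : j + 1 + d - (j + 1) = d := by omega
        have h2 : j + 1 + d - j = 1 + d := by omega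
        rw [h1, h2, qInt_add q (j + 1) 1, qInt_add q 1 d, qInt_one]
        ring

section Counting

open Module

variable {F V : Type*} [Field F] [AddCommGroup V] [Module F V]

theorem natCard_submodule_finrank_eq_one [Fintype F] :
    Nat.card {H : Submodule F V // finrank F H = 1} = qInt (Fintype.card F) (finrank F V) := by
  rw [← Nat.card_congr (Projectivization.equivSubmodule F V),
    Projectivization.card_of_finrank F V rfl, Nat.card_eq_fintype_card, qInt]

variable [Finite V]

theorem Submodule.finrank_comap_mkQ (X : Submodule F V) (H : Submodule F (V ⧸ X)) :
    finrank F (H.comap X.mkQ) = finrank F H + finrank F X := by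
  let f := X.mkQ.restrict (p := H.comap X.mkQ) (q := H) fun _ h => h
  have hf : LinearMap.range f = ⊤ := by
    rw [LinearMap.range_eq_top]
    rintro ⟨y, hy⟩
    obtain ⟨x, rfl⟩ := X.mkQ_surjective y
    exact ⟨⟨x, hy⟩, rfl⟩
  have hk : finrank F (LinearMap.ker f) = finrank F X := by
    suffices hmap : (LinearMap.ker f).map (H.comap X.mkQ).subtype = X by
      rw [← Submodule.finrank_map_subtype_eq, hmap]
    ext x
    simp only [f, Submodule.mem_map, LinearMap.mem_ker]
    constructor
    · rintro ⟨y, hy, rfl⟩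
      simpa using congrArg Subtype.val hy
    · intro hx
      have hx' : X.mkQ x = 0 := by simpa using hx
      exact ⟨⟨x, by simp [hx']⟩, Subtype.ext hx', rfl⟩
  rw [← LinearMap.finrank_range_add_finrank_ker f, hf, finrank_top, hk]

variable [Fintype F]

/-- The number of subspaces covering `X`. -/
theorem natCard_submodule_ge (X : Submodule F V) :
    Nat.card {Y : Submodule F V // X ≤ Y ∧ finrank F Y = finrank F X + 1} =
      qInt (Fintype.card F) (finrank F V - finrank F X) := by
  rw [← X.finrank_quotient, ← natCard_submodule_finrank_eq_one]
  symm
  refine Nat.card_congr (((Submodule.comapMkQRelIso X).toEquiv.subtypeEquiv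
    (q := fun Y : Set.Ici X => finrank F Y.1 = finrank F X + 1) ?_).trans
    (Equiv.subtypeSubtypeEquivSubtypeInter (X ≤ ·) fun Y => finrank F Y = finrank F X + 1))
  intro H
  change _ ↔ finrank F (H.comap X.mkQ) = _
  rw [Submodule.finrank_comap_mkQ]
  omega

/-- The number of hyperplanes of `Y`. -/
theorem natCard_submodule_le (Y : Submodule F V) {k : ℕ} (hY : finrank F Y = k + 1) :
    Nat.card {X : Submodule F V // X ≤ Y ∧ finrank F X = k} = qInt (Fintype.card F) (k + 1) := by
  have : Finite (Dual F Y) := Module.finite_of_finite F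
  rw [← hY, ← Subspace.dual_finrank_eq, ← natCard_submodule_finrank_eq_one]
  symm
  refine Nat.card_congr ((Equiv.trans ?_ (Y.mapIic.toEquiv.subtypeEquiv
    (p := fun X : Submodule F Y => finrank F X = k)
    (q := fun X : Set.Iic Y => finrank F X.1 = k) ?_)).trans
    (Equiv.subtypeSubtypeEquivSubtypeInter (· ≤ Y) fun X => finrank F X = k))
  · symm
    refine (Subspace.orderIsoFiniteDimensional.toEquiv.trans OrderDual.ofDual).subtypeEquiv ?_
    intro X
    change _ ↔ finrank F (X.dualAnnihilator) = 1
    have := Subspace.finrank_add_finrank_dualAnnihilator_eq X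
    omega
  · intro X
    change _ ↔ finrank F (X.map Y.subtype) = k
    rw [Submodule.finrank_map_subtype_eq]

end Counting

open Polynomial in
theorem Matrix.charpoly_mul_sub_scalar {V W : Type*} [Fintype V] [DecidableEq V] [Fintype W]
    [DecidableEq W] {R : Type*} [CommRing R] (A : Matrix V W R) (B : Matrix W V R) (c : R)
    (h : Fintype.card W ≤ Fintype.card V) :
    (A * B - scalar V c).charpoly =
      (X + C c) ^ (Fintype.card V - Fintype.card W) * (B * A - scalar W c).charpoly := by
  rw [charpoly_sub_scalar, charpoly_sub_scalar, charpoly_mul_comm_of_le _ _ h, mul_comp, pow_comp,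
    X_comp]

theorem SimpleGraph.neg_lapMatrix_eq {V : Type*} [Fintype V] [DecidableEq V] (G : SimpleGraph V)
    [DecidableRel G.Adj] {S : Matrix V V ℤ} {c d : ℤ} (hS : S = Matrix.scalar V c + G.adjMatrix ℤ)
    (hd : ∀ i, ∑ j, S i j = d) : -G.lapMatrix ℤ = S - Matrix.scalar V d := by
  have hdeg : ∀ i, (G.degree i : ℤ) = d - c := by
    intro i
    rw [← hd i, hS]
    simp only [Matrix.add_apply, Matrix.scalar_apply, Matrix.diagonal_apply, adjMatrix_apply,
      Finset.sum_add_distrib, Finset.sum_ite_eq, Finset.mem_univ, if_true,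
      ← degree_eq_sum_if_adj]
    ring
  subst hS
  ext i j
  by_cases hij : i = j
  · subst hij
    simp only [lapMatrix, degMatrix, Matrix.neg_apply, Matrix.sub_apply, Matrix.add_apply,
      Matrix.scalar_apply, Matrix.diagonal_apply_eq, hdeg]
    ring
  · simp only [lapMatrix, degMatrix, Matrix.neg_apply, Matrix.sub_apply, Matrix.add_apply,
      Matrix.scalar_apply, Matrix.diagonal_apply_ne _ hij]
    ring

section Grassmann

open Module

variable (F V : Type*) [Field F] [AddCommGroup V] [Module F V]

/-- The Grassmann graph on the `k`-dimensional subspaces of `V`. -/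
def grassmannGraph (k : ℕ) : SimpleGraph {X : Submodule F V // finrank F X = k} where
  Adj X Y := X ≠ Y ∧ finrank F ↥(X.1 ⊓ Y.1) = k - 1
  symm := ⟨fun _ _ h => ⟨h.1.symm, by rw [inf_comm]; exact h.2⟩⟩
  loopless := ⟨fun _ h => h.1 rfl⟩

open Classical in
/-- The inclusion matrix between `k`-dimensional and `k + 1`-dimensional subspaces. -/
noncomputable def inclusionMatrix (k : ℕ) : Matrix {X : Submodule F V // finrank F X = k}
    {X : Submodule F V // finrank F X = k + 1} ℤ :=
  Matrix.of fun X Y => if X.1 ≤ Y.1 then 1 else 0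

variable [Finite V]

noncomputable instance (k : ℕ) : Fintype {X : Submodule F V // finrank F X = k} :=
  Fintype.ofFinite _

variable {F V} {k : ℕ}

open Classical in
theorem sum_boole_eq_natCard (P : Submodule F V → Prop) :
    ∑ X : {X : Submodule F V // finrank F X = k}, (if P X.1 then 1 else 0 : ℤ) =
      Nat.card {X : Submodule F V // P X ∧ finrank F X = k} := by
  rw [Finset.sum_boole, ← Fintype.card_subtype, ← Nat.card_eq_fintype_card,
    Nat.card_congr
      (Equiv.subtypeSubtypeEquivSubtypeInter (fun X : Submodule F V => finrank F X = k) P)]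
  simp only [and_comm]

theorem sum_inclusionMatrix_left [Fintype F] (X : {X : Submodule F V // finrank F X = k}) :
    ∑ Y, inclusionMatrix F V k X Y = qInt (Fintype.card F) (finrank F V - k) := by
  have := natCard_submodule_ge X.1
  rw [X.2] at this
  rw [← this, ← sum_boole_eq_natCard]
  rfl

theorem sum_inclusionMatrix_right [Fintype F] (Y : {Y : Submodule F V // finrank F Y = k + 1}) :
    ∑ X, inclusionMatrix F V k X Y = qInt (Fintype.card F) (k + 1) := by
  rw [← natCard_submodule_le Y.1 Y.2, ← sum_boole_eq_natCard]
  rfl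

open Classical in
theorem transpose_inclusionMatrix_mul [Fintype F] :
    (inclusionMatrix F V k).transpose * inclusionMatrix F V k =
      Matrix.scalar _ (qInt (Fintype.card F) (k + 1) : ℤ) +
        (grassmannGraph F V (k + 1)).adjMatrix ℤ := by
  ext Y Y'
  by_cases hY : Y = Y'
  · subst hY
    rw [Matrix.mul_apply, Matrix.add_apply, SimpleGraph.adjMatrix_apply,
      if_neg (SimpleGraph.irrefl _), add_zero, Matrix.scalar_apply, Matrix.diagonal_apply_eq,
      ← sum_inclusionMatrix_right Y]
    refine Finset.sum_congr rfl fun _ _ => ?_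
    simp only [Matrix.transpose_apply, inclusionMatrix, Matrix.of_apply]
    split_ifs <;> rfl
  · have hle : ∀ X : {X : Submodule F V // finrank F X = k},
        inclusionMatrix F V k X Y * inclusionMatrix F V k X Y' =
          if X.1 ≤ Y.1 ⊓ Y'.1 then 1 else 0 := by
      intro X
      simp [inclusionMatrix, ← ite_and, le_inf_iff, and_comm]
    have hlt : finrank F ↥(Y.1 ⊓ Y'.1) < k + 1 := by
      refine lt_of_lt_of_eq (Submodule.finrank_lt_finrank_of_lt
        (inf_le_left.lt_of_ne fun h => hY ?_)) Y.2
      exact Subtype.ext (Submodule.eq_of_le_of_finrank_eq (inf_eq_left.1 h) (Y.2.trans Y'.2.symm))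
    simp only [Matrix.mul_apply, Matrix.transpose_apply, Matrix.add_apply,
      SimpleGraph.adjMatrix_apply, Matrix.scalar_apply, Matrix.diagonal_apply_ne _ hY, zero_add,
      hle]
    by_cases hk : finrank F ↥(Y.1 ⊓ Y'.1) = k
    · rw [if_pos (show (grassmannGraph F V (k + 1)).Adj Y Y' from ⟨hY, hk⟩),
        Finset.sum_eq_single_of_mem ⟨Y.1 ⊓ Y'.1, hk⟩ (Finset.mem_univ _),
        if_pos le_rfl]
      intro X _ hX
      refine if_neg fun h => hX (Subtype.ext ?_)
      exact Submodule.eq_of_le_of_finrank_eq h (X.2.trans hk.symm)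
    · rw [if_neg fun h : (grassmannGraph F V (k + 1)).Adj Y Y' => hk h.2]
      refine Finset.sum_eq_zero fun X _ => if_neg fun h => hk ?_
      have := Submodule.finrank_mono h
      have := X.2
      omega

open Classical in
theorem inclusionMatrix_mul_transpose [Fintype F] :
    inclusionMatrix F V k * (inclusionMatrix F V k).transpose =
      Matrix.scalar _ (qInt (Fintype.card F) (finrank F V - k) : ℤ) +
        (grassmannGraph F V k).adjMatrix ℤ := by
  ext X X'
  by_cases hX : X = X'
  · subst hX
    rw [Matrix.mul_apply, Matrix.add_apply, SimpleGraph.adjMatrix_apply,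
      if_neg (SimpleGraph.irrefl _), add_zero, Matrix.scalar_apply, Matrix.diagonal_apply_eq,
      ← sum_inclusionMatrix_left X]
    refine Finset.sum_congr rfl fun _ _ => ?_
    simp only [Matrix.transpose_apply, inclusionMatrix, Matrix.of_apply]
    split_ifs <;> rfl
  · have hle : ∀ Y : {Y : Submodule F V // finrank F Y = k + 1},
        inclusionMatrix F V k X Y * inclusionMatrix F V k X' Y =
          if X.1 ⊔ X'.1 ≤ Y.1 then 1 else 0 := by
      intro Y
      simp [inclusionMatrix, ← ite_and, sup_le_iff, and_comm]
    have hlt : k < finrank F ↥(X.1 ⊔ X'.1) := by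
      refine lt_of_eq_of_lt X.2.symm (Submodule.finrank_lt_finrank_of_lt
        (le_sup_left.lt_of_ne fun h => hX ?_))
      exact Subtype.ext (Submodule.eq_of_le_of_finrank_eq (sup_eq_left.1 h.symm)
        (X'.2.trans X.2.symm)).symm
    have hadj : finrank F ↥(X.1 ⊓ X'.1) = k - 1 ↔ finrank F ↥(X.1 ⊔ X'.1) = k + 1 := by
      have := Submodule.finrank_sup_add_finrank_inf_eq X.1 X'.1
      have := X.2
      have := X'.2
      omega
    simp only [Matrix.mul_apply, Matrix.transpose_apply, Matrix.add_apply,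
      SimpleGraph.adjMatrix_apply, Matrix.scalar_apply, Matrix.diagonal_apply_ne _ hX, zero_add,
      hle]
    by_cases hk : finrank F ↥(X.1 ⊔ X'.1) = k + 1
    · rw [if_pos (show (grassmannGraph F V k).Adj X X' from ⟨hX, hadj.2 hk⟩),
        Finset.sum_eq_single_of_mem ⟨X.1 ⊔ X'.1, hk⟩ (Finset.mem_univ _),
        if_pos le_rfl]
      intro Y _ hY
      refine if_neg fun h => hY (Subtype.ext ?_)
      exact (Submodule.eq_of_le_of_finrank_eq h (hk.trans Y.2.symm)).symm
    · rw [if_neg fun h : (grassmannGraph F V k).Adj X X' => hk (hadj.1 h.2)]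
      refine Finset.sum_eq_zero fun Y _ => if_neg fun h => hk ?_
      have := Submodule.finrank_mono h
      have := Y.2
      omega

theorem card_grassmann_mul_qInt [Fintype F] :
    Fintype.card {X : Submodule F V // finrank F X = k + 1} * qInt (Fintype.card F) (k + 1) =
      Fintype.card {X : Submodule F V // finrank F X = k} *
        qInt (Fintype.card F) (finrank F V - k) := by
  have h := Finset.sum_comm (s := Finset.univ) (t := Finset.univ) (f := inclusionMatrix F V k)
  simp only [sum_inclusionMatrix_left, sum_inclusionMatrix_right, Finset.sum_const,
    Finset.card_univ, nsmul_eq_mul] at h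
  exact_mod_cast h.symm

/-- The number of `k`-dimensional subspaces is the Gaussian binomial coefficient. -/
theorem card_grassmann [Fintype F] (k : ℕ) :
    Fintype.card {X : Submodule F V // finrank F X = k} =
      gaussBinom (Fintype.card F) (finrank F V) k := by
  induction k with
  | zero =>
    rw [gaussBinom_zero, Fintype.card_eq_one_iff]
    exact ⟨⟨⊥, finrank_bot F V⟩, fun X => Subtype.ext (Submodule.finrank_eq_zero.1 X.2)⟩
  | succ k ih =>
    refine Nat.eq_of_mul_eq_mul_right (qInt_pos (Fintype.card F) k.succ_pos) ?_
    rw [gaussBinom_succ_mul_qInt, card_grassmann_mul_qInt, ih]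

theorem card_grassmann_le [Fintype F] (hk : 2 * (k + 1) ≤ finrank F V) :
    Fintype.card {X : Submodule F V // finrank F X = k} ≤
      Fintype.card {X : Submodule F V // finrank F X = k + 1} := by
  refine Nat.le_of_mul_le_mul_right (card_grassmann_mul_qInt.ge.trans
    (Nat.mul_le_mul_left _ (qInt_mono (Fintype.card F) ?_)))
    (qInt_pos (Fintype.card F) (j := finrank F V - k) (by omega))
  omega

open Polynomial

open Classical in
theorem charpoly_neg_lapMatrix_grassmannGraph_succ [Fintype F]
    (hk : 2 * (k + 1) ≤ finrank F V) :
    (-(grassmannGraph F V (k + 1)).lapMatrix ℤ).charpoly =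
      (X + C (qInt (Fintype.card F) (k + 1) * qInt (Fintype.card F) (finrank F V - k) : ℤ)) ^
        (gaussBinom (Fintype.card F) (finrank F V) (k + 1) -
          gaussBinom (Fintype.card F) (finrank F V) k) *
      (-(grassmannGraph F V k).lapMatrix ℤ).charpoly := by
  rw [SimpleGraph.neg_lapMatrix_eq _ transpose_inclusionMatrix_mul
      (d := qInt (Fintype.card F) (k + 1) * qInt (Fintype.card F) (finrank F V - k)),
    SimpleGraph.neg_lapMatrix_eq _ inclusionMatrix_mul_transpose
      (d := qInt (Fintype.card F) (k + 1) * qInt (Fintype.card F) (finrank F V - k)),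
    Matrix.charpoly_mul_sub_scalar _ _ _ (card_grassmann_le hk), card_grassmann, card_grassmann]
  · intro X
    simp only [Matrix.mul_apply, Matrix.transpose_apply]
    rw [Finset.sum_comm]
    simp only [← Finset.mul_sum, sum_inclusionMatrix_right, ← Finset.sum_mul,
      sum_inclusionMatrix_left]
    ring
  · intro Y
    simp only [Matrix.mul_apply, Matrix.transpose_apply]
    rw [Finset.sum_comm]
    simp only [← Finset.mul_sum, sum_inclusionMatrix_left, ← Finset.sum_mul,
      sum_inclusionMatrix_right]

open Classical in
theorem charpoly_neg_lapMatrix_grassmannGraph [Fintype F] (m : ℕ) (hm : 2 * m ≤ finrank F V) :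
    (-(grassmannGraph F V m).lapMatrix ℤ).charpoly =
      X * ∏ k ∈ Finset.Icc 1 m,
        (X + C (qInt (Fintype.card F) k * qInt (Fintype.card F) (finrank F V - k + 1) : ℤ)) ^
          (gaussBinom (Fintype.card F) (finrank F V) k -
            gaussBinom (Fintype.card F) (finrank F V) (k - 1)) := by
  induction m with
  | zero =>
    have hcard : Fintype.card {X : Submodule F V // finrank F X = 0} = 1 := by
      rw [card_grassmann, gaussBinom_zero]
    have hsub := Fintype.card_le_one_iff_subsingleton.1 hcard.le
    have hbot : grassmannGraph F V 0 = ⊥ := Subsingleton.elim _ _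
    have hlap : -(grassmannGraph F V 0).lapMatrix ℤ = 0 := by
      ext i j
      rw [Subsingleton.elim j i]
      simp [SimpleGraph.lapMatrix, SimpleGraph.degMatrix]
    rw [hlap, Matrix.charpoly_zero, hcard]
    simp
  | succ m ih =>
    have h : finrank F V - (m + 1) + 1 = finrank F V - m := by omega
    rw [charpoly_neg_lapMatrix_grassmannGraph_succ hm, ih (by omega),
      Finset.prod_Icc_succ_top (by omega), h, Nat.add_sub_cancel]
    ring

end Grassmann

/-- For `0 ≤ m ≤ n/2`, the number of rooted spanning trees of the Grassmann graph
`C_q(n, m)` (vertices: `m`-dimensional subspaces of `F_q^n`, edges between subspaces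
meeting in dimension `m-1`) equals
`Π_{k=1}^{m} ([k]_q [n-k+1]_q)^{[n,k]_q - [n,k-1]_q}`. -/
theorem card_rooted_spanning_trees_grassmann (F : Type) [Field F] [Fintype F]
    (n m : ℕ) (hm : 2 * m ≤ n)
    (G : SimpleGraph {X : Submodule F (Fin n → F) // Module.finrank F ↥X = m})
    (hG : ∀ X Y : {X : Submodule F (Fin n → F) // Module.finrank F ↥X = m},
      G.Adj X Y ↔ X ≠ Y ∧ Module.finrank F ↥(X.1 ⊓ Y.1) = m - 1) :
    Nat.card
        ({T : SimpleGraph {X : Submodule F (Fin n → F) // Module.finrank F ↥X = m} //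
            T ≤ G ∧ T.IsTree} ×
          {X : Submodule F (Fin n → F) // Module.finrank F ↥X = m}) =
      ∏ k ∈ Finset.Icc 1 m,
        (qInt (Fintype.card F) k * qInt (Fintype.card F) (n - k + 1)) ^
          (gaussBinom (Fintype.card F) n k - gaussBinom (Fintype.card F) n (k - 1)) := by
  classical
  have hfin : Module.finrank F (Fin n → F) = n := Module.finrank_fin_fun F
  have hGG : G = grassmannGraph F (Fin n → F) m := by
    ext X Y
    exact hG X Y
  have hne : Nonempty {X : Submodule F (Fin n → F) // Module.finrank F ↥X = m} := by
    rw [← Fintype.card_pos_iff, card_grassmann, hfin]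
    exact gaussBinom_pos _ (by omega)
  have h := SimpleGraph.coeff_one_charpoly_neg_lapMatrix (grassmannGraph F (Fin n → F) m)
  rw [charpoly_neg_lapMatrix_grassmannGraph m (by omega), Polynomial.coeff_X_mul,
    Polynomial.coeff_zero_eq_eval_zero, Polynomial.eval_prod] at h
  subst hGG
  rw [← Nat.cast_inj (R := ℤ), ← h]
  simp [hfin]
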